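/- arXiv:1307.0336 — 2 statements merged into one kernel-verified Lean document; each statement's English description precedes it below -/
import Mathlib

section
/- Assume 1/A² < B/C < 1/A + √(A²−1)/A². Set α = 2a, β = A(A⁴B²−C²)/(A³B−C) and γ = A⁴C² − β·A³C. Then β > 0, β² + 4γ·exp(−α²/t) > 0 for every t ∈ (0,Δ], the Daniels curve S with parameters (α,β,γ) satisfies S(Δ/2) = b and S(Δ) = c, and S(t) → a as t → 0⁺. -/
open Real Filter

/-- A number at least `β / 2` solving `X² - β X = γ u` is the larger root. -/
lemma half_add_sqrt_discrim_eq {β γ u X : ℝ} (h : X ^ 2 - β * X = γ * u) (hX : β ≤ 2 * X) :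
    (β + √(β ^ 2 + 4 * γ * u)) / 2 = X := by
  have h' : β ^ 2 + 4 * γ * u = (2 * X - β) ^ 2 := by linear_combination -4 * h
  rw [h', Real.sqrt_sq (by linarith)]
  ring

/-- Positivity of `β² + 4 γ u` passes from `v` down to every `u ∈ (0, v]`. -/
lemma discrim_pos_of_le {β γ u v : ℝ} (hβ : 0 < β) (hu : 0 < u) (huv : u ≤ v)
    (hv : 0 < β ^ 2 + 4 * γ * v) : 0 < β ^ 2 + 4 * γ * u := by
  rcases le_total 0 γ with h | h
  · positivity
  · linear_combination hv + 4 * mul_le_mul_of_nonpos_left huv h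

/-- `x² - 2 A x + 1` is negative for `x` between `1` and its larger root. -/
lemma quadratic_neg_of_lt {A x : ℝ} (hA : 1 < A) (hx1 : 1 < x) (hx2 : x < A + √(A ^ 2 - 1)) :
    x ^ 2 - 2 * A * x + 1 < 0 := by
  have hs : √(A ^ 2 - 1) ^ 2 = A ^ 2 - 1 := Real.sq_sqrt (by nlinarith)
  have hs1 : A - 1 < √(A ^ 2 - 1) := Real.lt_sqrt_of_sq_lt (by nlinarith)
  linear_combination mul_pos (sub_pos.2 hx2) (by linarith : 0 < x - A + √(A ^ 2 - 1)) + hs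

/-- As `t → 0⁺`, a Daniels curve with `α ≠ 0` and `β > 0` tends to `α / 2`. -/
lemma tendsto_daniels_zero {α β : ℝ} (γ : ℝ) (hα : α ≠ 0) (hβ : 0 < β) :
    Tendsto (fun t : ℝ => α / 2 - (t / α) * log ((β + √(β ^ 2 + 4 * γ * exp (-α ^ 2 / t))) / 2))
      (nhdsWithin 0 (Set.Ioi 0)) (nhds (α / 2)) := by
  have hexp : Tendsto (fun t : ℝ => exp (-α ^ 2 / t)) (nhdsWithin 0 (Set.Ioi 0)) (nhds 0) := by
    have h : Tendsto (fun t : ℝ => -α ^ 2 / t) (nhdsWithin 0 (Set.Ioi 0)) atBot := by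
      simp only [div_eq_mul_inv]
      exact tendsto_inv_nhdsGT_zero.const_mul_atTop_of_neg (neg_neg_of_pos (by positivity))
    exact tendsto_exp_atBot.comp h
  have hroot : Tendsto (fun t : ℝ => (β + √(β ^ 2 + 4 * γ * exp (-α ^ 2 / t))) / 2)
      (nhdsWithin 0 (Set.Ioi 0)) (nhds β) := by
    have h := ((((hexp.const_mul (4 * γ)).const_add (β ^ 2)).sqrt).const_add β).div_const 2
    rwa [mul_zero, add_zero, Real.sqrt_sq hβ.le, add_self_div_two] at h
  have hid : Tendsto (fun t : ℝ => t / α) (nhdsWithin 0 (Set.Ioi 0)) (nhds 0) := by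
    have h : Tendsto (fun t : ℝ => t / α) (nhds 0) (nhds (0 / α)) := tendsto_id.div_const α
    rw [zero_div] at h
    exact tendsto_nhdsWithin_of_tendsto_nhds h
  simpa using (hid.mul (hroot.log hβ.ne')).const_sub (α / 2)

theorem stmt_0 (Δ a b c : ℝ) (hΔ : 0 < Δ) (ha : 0 < a)
    (A B C : ℝ) (hA : A = exp (2*a^2/Δ)) (hB : B = exp (-(4*a*b)/Δ))
    (hC : C = exp (-(2*a*c)/Δ))
    (h1 : 1/A^2 < B/C) (h2 : B/C < 1/A + Real.sqrt (A^2 - 1)/A^2)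
    (α β γ : ℝ) (hα : α = 2*a)
    (hβ : β = A*(A^4*B^2 - C^2)/(A^3*B - C))
    (hγ : γ = A^4*C^2 - β*(A^3*C)) :
    0 < β ∧
    (∀ t ∈ Set.Ioc (0:ℝ) Δ, 0 < β^2 + 4*γ*exp (-α^2/t)) ∧
    α/2 - (Δ/2)/α * log ((β + Real.sqrt (β^2 + 4*γ*exp (-α^2/(Δ/2))))/2) = b ∧
    α/2 - Δ/α * log ((β + Real.sqrt (β^2 + 4*γ*exp (-α^2/Δ)))/2) = c ∧
    Tendsto (fun t : ℝ => α/2 - (t/α) * log ((β + Real.sqrt (β^2 + 4*γ*exp (-α^2/t)))/2))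
      (nhdsWithin 0 (Set.Ioi 0)) (nhds a) := by
  have hA1 : 1 < A := by rw [hA]; exact one_lt_exp_iff.2 (by positivity)
  have hA0 : 0 < A := by linarith
  have hC0 : 0 < C := by rw [hC]; exact exp_pos _
  have hu : exp (-α ^ 2 / Δ) = (A ^ 2)⁻¹ := by
    rw [hA, hα, ← exp_nat_mul, ← exp_neg]; congr 1; push_cast; ring
  have hv : exp (-α ^ 2 / (Δ / 2)) = (A ^ 4)⁻¹ := by
    rw [hA, hα, ← exp_nat_mul, ← exp_neg]; congr 1; push_cast; field_simp; ring
  have hlogX : log (A * C) = 2 * a * (a - c) / Δ := by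
    rw [hA, hC, ← exp_add, log_exp]; ring
  have hlogY : log (A ^ 2 * B) = 4 * a * (a - b) / Δ := by
    rw [hA, hB, ← exp_nat_mul, ← exp_add, log_exp]; push_cast; ring
  clear hA hB hC
  obtain ⟨x, hx⟩ : ∃ x, x = A ^ 2 * (B / C) := ⟨_, rfl⟩
  have hBx : A ^ 2 * B = x * C := by rw [hx]; field_simp
  have hx1 : 1 < x := by
    rw [hx]
    rwa [div_lt_iff₀ (by positivity), mul_comm] at h1
  have hquad : x ^ 2 - 2 * A * x + 1 < 0 := by
    refine quadratic_neg_of_lt hA1 hx1 ?_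
    have h := mul_lt_mul_of_pos_left h2 (by positivity : 0 < A ^ 2)
    have h' : A ^ 2 * (1 / A + √(A ^ 2 - 1) / A ^ 2) = A + √(A ^ 2 - 1) := by field_simp
    rwa [h', ← hx] at h
  have hD : 0 < A * x - 1 := by nlinarith
  have hβD : β * (A * x - 1) = A * C * (x ^ 2 - 1) := by
    have e1 : A ^ 3 * B - C = C * (A * x - 1) := by linear_combination A * hBx
    have e2 : A ^ 4 * B ^ 2 - C ^ 2 = C ^ 2 * (x ^ 2 - 1) := by
      linear_combination (A ^ 2 * B + x * C) * hBx
    rw [hβ, e1, e2]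
    field_simp
  have hβ0 : 0 < β := by
    refine pos_of_mul_pos_left (b := A * x - 1) ?_ hD.le
    rw [hβD]
    have : 0 < x ^ 2 - 1 := by nlinarith
    positivity
  have hβX : β < 2 * (A * C) := by
    refine lt_of_mul_lt_mul_right ?_ hD.le
    rw [hβD]
    linear_combination (A * C) * hquad
  have hβY : β ≤ 2 * (A ^ 2 * B) := by
    refine le_of_mul_le_mul_right ?_ hD
    rw [hβD, hBx]
    have h : 0 ≤ A * (x - 1) ^ 2 + 2 * (A - 1) * x :=
      add_nonneg (by positivity) (mul_nonneg (by linarith) (by linarith))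
    linear_combination C * h
  have hX : (A * C) ^ 2 - β * (A * C) = γ * (A ^ 2)⁻¹ := by
    rw [hγ]; field_simp
  have hY : (A ^ 2 * B) ^ 2 - β * (A ^ 2 * B) = γ * (A ^ 4)⁻¹ := by
    rw [hγ, hBx]
    field_simp
    linear_combination -hβD
  have hα0 : α / 2 = a := by rw [hα]; ring
  refine ⟨hβ0, ?_, ?_, ?_, ?_⟩
  · rintro t ⟨ht0, ht⟩
    have hle : exp (-α ^ 2 / t) ≤ (A ^ 2)⁻¹ := by
      rw [← hu, exp_le_exp, neg_div, neg_div, neg_le_neg_iff]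
      exact div_le_div_of_nonneg_left (sq_nonneg α) ht0 ht
    have hend : 0 < β ^ 2 + 4 * γ * (A ^ 2)⁻¹ := by
      have : β ^ 2 + 4 * γ * (A ^ 2)⁻¹ = (2 * (A * C) - β) ^ 2 := by linear_combination -4 * hX
      rw [this]
      exact pow_pos (sub_pos.2 hβX) 2
    exact discrim_pos_of_le hβ0 (exp_pos _) hle hend
  · rw [hv, half_add_sqrt_discrim_eq hY hβY, hlogY, hα0, hα]
    field_simp
    ring
  · rw [hu, half_add_sqrt_discrim_eq hX hβX.le, hlogX, hα0, hα]
    field_simp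
    ring
  · simpa only [hα0] using tendsto_daniels_zero γ (by rw [hα]; positivity : α ≠ 0) hβ0
end

section
/- Assume 1/A² < B/C < 1/A + √(A²−1)/A². Suppose β' > 0 and γ' ∈ ℝ satisfy β'² + 4γ'·exp(−4a²/t) > 0 for all t ∈ (0,Δ], and the Daniels curve S' with parameters (2a, β', γ') satisfies S'(Δ/2) = b and S'(Δ) = c. Then β' = A(A⁴B²−C²)/(A³B−C) and γ' = A⁴C² − β'·A³C. -/
open Real

/-- The larger root `x` of `x ^ 2 - β * x = γ * E`. -/
lemma sq_sub_mul_of_half_add_sqrt {β γ E x : ℝ} (h : 0 ≤ β ^ 2 + 4 * γ * E)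
    (hx : (β + √(β ^ 2 + 4 * γ * E)) / 2 = x) : x ^ 2 - β * x = γ * E := by
  have hs := Real.sq_sqrt h
  subst hx
  linear_combination hs / 4

/-- Solving `α / 2 - t / α * log x = s` for `x`. -/
lemma eq_exp_of_sub_mul_log_eq {α t x s : ℝ} (hα : α ≠ 0) (ht : t ≠ 0) (hx : 0 < x)
    (h : α / 2 - t / α * log x = s) : x = exp (α * (α / 2 - s) / t) := by
  refine (Real.exp_log hx).symm.trans ?_
  rw [← h]
  congr 1
  field_simp
  ring

theorem stmt_1 (Δ a b c : ℝ) (hΔ : 0 < Δ) (ha : 0 < a)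
    (A B C : ℝ) (hA : A = exp (2*a^2/Δ)) (hB : B = exp (-(4*a*b)/Δ))
    (hC : C = exp (-(2*a*c)/Δ))
    (h1 : 1/A^2 < B/C) (h2 : B/C < 1/A + Real.sqrt (A^2 - 1)/A^2)
    (β' γ' : ℝ) (hβ' : 0 < β')
    (hpos : ∀ t ∈ Set.Ioc (0:ℝ) Δ, 0 < β'^2 + 4*γ'*exp (-(2*a)^2/t))
    (hmid : (2*a)/2 - (Δ/2)/(2*a) * log ((β' + Real.sqrt (β'^2 + 4*γ'*exp (-(2*a)^2/(Δ/2))))/2) = b)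
    (hend : (2*a)/2 - Δ/(2*a) * log ((β' + Real.sqrt (β'^2 + 4*γ'*exp (-(2*a)^2/Δ)))/2) = c) :
    β' = A*(A^4*B^2 - C^2)/(A^3*B - C) ∧ γ' = A^4*C^2 - β'*(A^3*C) := by
  have hA0 : 0 < A := hA ▸ exp_pos _
  have hB0 : 0 < B := hB ▸ exp_pos _
  have hC0 : 0 < C := hC ▸ exp_pos _
  have hA1 : 1 < A := by
    rw [hA]
    exact Real.one_lt_exp_iff.2 (by positivity)
  have hα : 2 * a ≠ 0 := by positivity
  have hE1 : exp (-(2*a)^2/Δ) * A ^ 2 = 1 := by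
    rw [hA, ← Real.exp_nat_mul, ← Real.exp_add, Real.exp_eq_one_iff]
    push_cast
    ring
  have hE2 : exp (-(2*a)^2/(Δ/2)) * A ^ 4 = 1 := by
    rw [hA, ← Real.exp_nat_mul, ← Real.exp_add, Real.exp_eq_one_iff]
    push_cast
    field_simp
    ring
  have hp1 := hpos Δ ⟨hΔ, le_rfl⟩
  have hp2 := hpos (Δ / 2) ⟨by linarith, by linarith⟩
  have hX1 := eq_exp_of_sub_mul_log_eq hα hΔ.ne' (by positivity) hend
  have hX2 := eq_exp_of_sub_mul_log_eq hα (by positivity) (by positivity) hmid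
  have hAC : exp (2*a * (2*a/2 - c) / Δ) = A * C := by
    rw [hA, hC, ← Real.exp_add]
    congr 1
    ring
  have hAB : exp (2*a * (2*a/2 - b) / (Δ/2)) = A ^ 2 * B := by
    rw [hA, hB, ← Real.exp_nat_mul, ← Real.exp_add]
    congr 1
    push_cast
    field_simp
    ring
  have hq1 := sq_sub_mul_of_half_add_sqrt hp1.le (hX1.trans hAC)
  have hq2 := sq_sub_mul_of_half_add_sqrt hp2.le (hX2.trans hAB)
  have hγ1 : γ' = A^4*C^2 - β'*(A^3*C) := by
    linear_combination (-A ^ 2) * hq1 - γ' * hE1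
  have hγ2 : γ' = A^8*B^2 - β'*(A^6*B) := by
    linear_combination (-A ^ 4) * hq2 - γ' * hE2
  have hβ : β' * (A^3*B - C) = A*(A^4*B^2 - C^2) := by
    apply mul_left_cancel₀ (pow_pos hA0 3).ne'
    linear_combination hγ2 - hγ1
  have hne : A^3*B - C ≠ 0 := by
    intro h0
    rw [h0, mul_zero] at hβ
    have hsq : A ^ 4 * B ^ 2 * (A ^ 2 - 1) = 0 := by
      apply mul_left_cancel₀ hA0.ne'
      linear_combination hβ + A * (A ^ 3 * B + C) * h0
    have : 0 < A ^ 2 - 1 := by nlinarith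
    have : 0 < A ^ 4 * B ^ 2 * (A ^ 2 - 1) := by positivity
    linarith
  exact ⟨(eq_div_iff hne).2 hβ, hγ1⟩
end
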